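/- Assume M is ∞-spanned and the indexing of the generators is adapted as in the Labelling lemma. Then the shortlex automaton ShortLex with the start state ∅ removed is strongly connected: for any two reachable non-fail states D and D', both different from ∅, there exists a word u over {1, …, n} such that all transitions along u starting from D are defined and δ̂(D, u) = D'. -/

import Mathlib

open scoped BigOperators

/-- The simple root `α_i`, the `i`-th standard basis vector of `ℝ^n`. -/
noncomputable def simpleRoot {n : ℕ} (i : Fin n) : Fin n → ℝ := Pi.single i 1

/-- The symmetric bilinear form `B` associated to the Coxeter matrix `M`, determined by
`B(α_i, α_j) = -cos (π / M i j)` when `M i j ≠ 0` and `B(α_i, α_j) = -1` when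
`M i j = 0` (the label `∞`). -/
noncomputable def bform {n : ℕ} (M : CoxeterMatrix (Fin n)) (u v : Fin n → ℝ) : ℝ :=
  ∑ i, ∑ j, u i * (if M i j = 0 then -1 else -Real.cos (Real.pi / (M i j))) * v j

/-- The simple reflection `σ_i(v) = v - 2 B(v, α_i) α_i`. -/
noncomputable def simpleRefl {n : ℕ} (M : CoxeterMatrix (Fin n)) (i : Fin n)
    (v : Fin n → ℝ) : Fin n → ℝ :=
  v - (2 * bform M v (simpleRoot i)) • simpleRoot i

/-- The set `Σ` of small roots of `M`: the smallest set of vectors containing the simple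
roots `α_1, …, α_n` and such that whenever `v ∈ Σ` and `-1 < B(v, α_i) < 0`, also
`σ_i(v) ∈ Σ`. -/
inductive IsSmallRoot {n : ℕ} (M : CoxeterMatrix (Fin n)) : (Fin n → ℝ) → Prop
  | simple (i : Fin n) : IsSmallRoot M (simpleRoot i)
  | reflect {v : Fin n → ℝ} (i : Fin n) : IsSmallRoot M v →
      -1 < bform M v (simpleRoot i) → bform M v (simpleRoot i) < 0 →
      IsSmallRoot M (simpleRefl M i v)

/-- The transition function of the geodesic automaton `Geo` (defined when `α_i ∉ D`):
`δ(D, i) = {α_i} ∪ (σ_i(D) ∩ Σ)`. -/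
noncomputable def stepGeo {n : ℕ} (M : CoxeterMatrix (Fin n)) (D : Set (Fin n → ℝ))
    (i : Fin n) : Set (Fin n → ℝ) :=
  insert (simpleRoot i) (simpleRefl M i '' D ∩ {v | IsSmallRoot M v})

/-- The transition function of the shortlex automaton `ShortLex` (defined when `α_i ∉ D`):
`δ(D, i) = {α_i} ∪ ((σ_i(D) ∪ {σ_i(α_l) : l < i}) ∩ Σ)`. -/
noncomputable def stepSL {n : ℕ} (M : CoxeterMatrix (Fin n)) (D : Set (Fin n → ℝ))
    (i : Fin n) : Set (Fin n → ℝ) :=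
  insert (simpleRoot i)
    ((simpleRefl M i '' D ∪ simpleRefl M i '' {v | ∃ l : Fin n, l < i ∧ v = simpleRoot l})
      ∩ {v | IsSmallRoot M v})

/-- All transitions of the automaton with transition function `step` are defined (do not
fail) when reading the word `u` from the state `D`; a transition out of `D` along the letter
`i` is defined exactly when `α_i ∉ D`. -/
def DefinedFrom {n : ℕ} (step : Set (Fin n → ℝ) → Fin n → Set (Fin n → ℝ)) :
    Set (Fin n → ℝ) → List (Fin n) → Prop
  | _, [] => True
  | D, i :: u => simpleRoot i ∉ D ∧ DefinedFrom step (step D i) u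

/-- The enhanced transition function `δ̂(D, u)`: the state obtained by reading the word `u`
from the state `D`. -/
def run {n : ℕ} (step : Set (Fin n → ℝ) → Fin n → Set (Fin n → ℝ))
    (D : Set (Fin n → ℝ)) (u : List (Fin n)) : Set (Fin n → ℝ) :=
  u.foldl step D

/-- A state is reachable if it is obtained from the start state `∅` by reading some word all
of whose transitions are defined. -/
def Reachable {n : ℕ} (step : Set (Fin n → ℝ) → Fin n → Set (Fin n → ℝ))
    (D : Set (Fin n → ℝ)) : Prop :=
  ∃ u : List (Fin n), DefinedFrom step ∅ u ∧ run step ∅ u = D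

/-- The graph of `∞`-edges of the Coxeter matrix `M`: `i ≠ j` are adjacent iff `M i j = 0`. -/
def infGraph {n : ℕ} (M : CoxeterMatrix (Fin n)) : SimpleGraph (Fin n) :=
  SimpleGraph.fromRel (fun i j => M i j = 0)

/-- The indexing of the generators is adapted as in the Labelling lemma: there is a spanning
tree `Γ` of the graph of `∞`-edges containing the edges `{1,2}` and `{2,3}`, such that along
every simple path in `Γ` from the vertex `1` to a leaf of `Γ` the labels strictly increase.
(Vertices `1, 2, 3` correspond to the indices `0, 1, 2` of `Fin n`.) -/
def AdaptedLabelling {n : ℕ} (hn : 3 ≤ n) (M : CoxeterMatrix (Fin n)) : Prop :=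
  ∃ Γ : SimpleGraph (Fin n), Γ ≤ infGraph M ∧ Γ.Connected ∧ Γ.IsAcyclic ∧
    Γ.Adj ⟨0, by omega⟩ ⟨1, by omega⟩ ∧ Γ.Adj ⟨1, by omega⟩ ⟨2, by omega⟩ ∧
    ∀ (v : Fin n) (p : Γ.Walk ⟨0, by omega⟩ v), p.IsPath → (∃! w : Fin n, Γ.Adj v w) →
      p.support.Chain' (· < ·)

/-- The value `B(α_k, α_i)` of the form on two simple roots. -/
noncomputable def formCoeff {n : ℕ} (M : CoxeterMatrix (Fin n)) (k i : Fin n) : ℝ :=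
  if M k i = 0 then -1 else -Real.cos (Real.pi / (M k i))

theorem bform_simpleRoot {n : ℕ} (M : CoxeterMatrix (Fin n)) (v : Fin n → ℝ) (i : Fin n) :
    bform M v (simpleRoot i) = ∑ k, v k * formCoeff M k i := by
  simp [bform, simpleRoot, formCoeff, Pi.single_apply]

theorem formCoeff_eq_zero_or_le {n : ℕ} (M : CoxeterMatrix (Fin n)) {k i : Fin n} (h : k ≠ i) :
    formCoeff M k i = 0 ∨ formCoeff M k i ≤ -(1 / 2) := by
  unfold formCoeff
  split_ifs with h0
  · right; norm_num
  · have h1 : M k i ≠ 1 := M.off_diagonal k i h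
    rcases (show M k i = 2 ∨ 3 ≤ M k i by omega) with h2 | h3
    · left; simp [h2]
    · right
      have h3' : (3 : ℝ) ≤ (M k i : ℝ) := by exact_mod_cast h3
      have hle : Real.pi / (M k i : ℝ) ≤ Real.pi / 3 :=
        div_le_div_of_nonneg_left Real.pi_pos.le (by norm_num) h3'
      have hcos := Real.cos_le_cos_of_nonneg_of_le_pi
        (div_nonneg Real.pi_pos.le (by linarith)) (by linarith [Real.pi_pos]) hle
      rw [Real.cos_pi_div_three] at hcos
      linarith

theorem bform_simpleRoot_le {n : ℕ} (M : CoxeterMatrix (Fin n)) {v : Fin n → ℝ}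
    (hv : ∀ k, v k = 0 ∨ 1 ≤ v k) {i : Fin n} (hi : v i = 0) (k : Fin n) :
    bform M v (simpleRoot i) ≤ v k * formCoeff M k i := by
  have hnonpos : ∀ l, v l * formCoeff M l i ≤ 0 := by
    intro l
    by_cases hl : l = i
    · simp [hl, hi]
    · have h0 : 0 ≤ v l := by rcases hv l with h | h <;> linarith
      have h1 : formCoeff M l i ≤ 0 := by
        rcases formCoeff_eq_zero_or_le M hl with h | h <;> linarith
      exact mul_nonpos_of_nonneg_of_nonpos h0 h1
  rw [bform_simpleRoot, ← Finset.add_sum_erase _ _ (Finset.mem_univ k)]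
  have := Finset.sum_nonpos (s := Finset.univ.erase k) (fun l _ => hnonpos l)
  linarith

theorem simpleRefl_apply_of_ne {n : ℕ} (M : CoxeterMatrix (Fin n)) {i k : Fin n} (h : k ≠ i)
    (v : Fin n → ℝ) : simpleRefl M i v k = v k := by
  simp [simpleRefl, simpleRoot, h]

theorem simpleRefl_apply_self {n : ℕ} (M : CoxeterMatrix (Fin n)) (i : Fin n)
    (v : Fin n → ℝ) : simpleRefl M i v i = v i - 2 * bform M v (simpleRoot i) := by
  simp [simpleRefl, simpleRoot]

theorem CoxeterMatrix.ne_of_eq_zero {n : ℕ} (M : CoxeterMatrix (Fin n)) {i j : Fin n}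
    (h : M i j = 0) : i ≠ j := by
  rintro rfl
  simp at h

theorem bform_simpleRoot_le_neg_one {n : ℕ} (M : CoxeterMatrix (Fin n)) {v : Fin n → ℝ}
    (hv : ∀ k, v k = 0 ∨ 1 ≤ v k) {i j : Fin n} (hi : v i = 0) (hij : M i j = 0)
    (hj : v j ≠ 0) : bform M v (simpleRoot i) ≤ -1 := by
  have h := bform_simpleRoot_le M hv hi j
  rw [M.symmetric] at hij
  simp only [formCoeff, hij, if_true] at h
  rcases hv j with h' | h'
  · exact absurd h' hj
  · linarith

/-- Every nonzero coefficient of a small root is at least `1`. -/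
theorem IsSmallRoot.eq_zero_or_one_le {n : ℕ} {M : CoxeterMatrix (Fin n)} {v : Fin n → ℝ}
    (hv : IsSmallRoot M v) : ∀ k, v k = 0 ∨ 1 ≤ v k := by
  induction hv with
  | simple i =>
    intro k
    by_cases h : k = i <;> simp [simpleRoot, h]
  | @reflect v i _ _ hneg ih =>
    intro k
    by_cases hk : k = i
    · subst hk
      right
      rw [simpleRefl_apply_self]
      rcases ih k with h0 | h1
      · obtain ⟨l, hl⟩ : ∃ l, v l * formCoeff M l k < 0 := by
          by_contra! hcon
          rw [bform_simpleRoot] at hneg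
          exact absurd (Finset.sum_nonneg fun l _ => hcon l) (not_le.mpr hneg)
        have hlk : l ≠ k := by
          rintro rfl
          simp [h0] at hl
        have hle := bform_simpleRoot_le M ih h0 l
        rcases ih l with h | h
        · simp [h] at hl
        rcases formCoeff_eq_zero_or_le M hlk with h' | h'
        · simp [h'] at hl
        · nlinarith
      · linarith
    · rw [simpleRefl_apply_of_ne M hk]
      exact ih k

/-- The support of a small root contains no edge labelled `∞`. -/
theorem IsSmallRoot.eq_zero_of_ne_zero {n : ℕ} {M : CoxeterMatrix (Fin n)} {v : Fin n → ℝ}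
    (hv : IsSmallRoot M v) : ∀ j k, M j k = 0 → v j ≠ 0 → v k = 0 := by
  induction hv with
  | simple i =>
    intro j k hjk hj
    have hne := M.ne_of_eq_zero hjk
    have hji : j = i := by
      by_contra h
      exact hj (by simp [simpleRoot, h])
    simp [simpleRoot, ← hji, hne.symm]
  | @reflect v i hv hgt _ ih =>
    have key : ∀ k, M i k = 0 → v k = 0 := by
      intro k hik
      by_contra hk
      have hi : v i = 0 := ih k i (by rw [M.symmetric]; exact hik) hk
      linarith [bform_simpleRoot_le_neg_one M hv.eq_zero_or_one_le hi hik hk]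
    intro j k hjk hj
    have hne := M.ne_of_eq_zero hjk
    by_cases hji : j = i
    · subst hji
      rw [simpleRefl_apply_of_ne M hne.symm]
      exact key k hjk
    · rw [simpleRefl_apply_of_ne M hji] at hj
      by_cases hki : k = i
      · subst hki
        exact absurd (key j (by rw [M.symmetric]; exact hjk)) hj
      · rw [simpleRefl_apply_of_ne M hki]
        exact ih j k hjk hj

theorem IsSmallRoot.exists_ne_zero {n : ℕ} {M : CoxeterMatrix (Fin n)} {v : Fin n → ℝ}
    (hv : IsSmallRoot M v) : ∃ k, v k ≠ 0 := by
  cases hv with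
  | simple i => exact ⟨i, by simp [simpleRoot]⟩
  | @reflect v i hv _ hneg =>
    refine ⟨i, ?_⟩
    rw [simpleRefl_apply_self]
    rcases hv.eq_zero_or_one_le i with h | h <;> linarith

/-- Reflecting a small root in a vertex joined to its support by an `∞`-edge never yields a
small root. -/
theorem IsSmallRoot.not_isSmallRoot_simpleRefl {n : ℕ} {M : CoxeterMatrix (Fin n)}
    {v : Fin n → ℝ} (hv : IsSmallRoot M v) {i j : Fin n} (hij : M i j = 0) (hj : v j ≠ 0) :
    ¬ IsSmallRoot M (simpleRefl M i v) := by
  intro hs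
  have hji : M j i = 0 := by rw [M.symmetric]; exact hij
  have hi : v i = 0 := hv.eq_zero_of_ne_zero j i hji hj
  have hB := bform_simpleRoot_le_neg_one M hv.eq_zero_or_one_le hi hij hj
  have h := hs.eq_zero_of_ne_zero j i hji
    (by rwa [simpleRefl_apply_of_ne M (M.ne_of_eq_zero hji)])
  rw [simpleRefl_apply_self, hi] at h
  linarith

theorem isSmallRoot_of_mem_stepSL {n : ℕ} {M : CoxeterMatrix (Fin n)} {D : Set (Fin n → ℝ)}
    {i : Fin n} {v : Fin n → ℝ} (h : v ∈ stepSL M D i) : IsSmallRoot M v := by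
  rcases h with rfl | h
  · exact .simple i
  · exact h.2

/-- Every element of a state reached through the letter `i` is either `α_i`, or a small root
of the form `σ_i(w)` with `w` in the previous state or `w = α_l`, `l < i`. -/
theorem mem_stepSL_iff {n : ℕ} {M : CoxeterMatrix (Fin n)} {D : Set (Fin n → ℝ)} {i : Fin n}
    {v : Fin n → ℝ} : v ∈ stepSL M D i ↔ v = simpleRoot i ∨
      ∃ w, (w ∈ D ∨ ∃ l < i, w = simpleRoot l) ∧ simpleRefl M i w = v ∧ IsSmallRoot M v := by
  simp only [stepSL, Set.mem_insert_iff, Set.mem_inter_iff, Set.mem_union, Set.mem_image,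
    Set.mem_ofPred_eq]
  refine or_congr_right ⟨?_, ?_⟩
  · rintro ⟨⟨w, hw, h⟩ | ⟨w, hw, h⟩, hs⟩
    exacts [⟨w, .inl hw, h, hs⟩, ⟨w, .inr hw, h, hs⟩]
  · rintro ⟨w, hw | hw, h, hs⟩
    exacts [⟨.inl ⟨w, hw, h⟩, hs⟩, ⟨.inr ⟨w, hw, h⟩, hs⟩]

theorem apply_eq_zero_of_mem_stepSL {n : ℕ} {M : CoxeterMatrix (Fin n)}
    {D : Set (Fin n → ℝ)} (hD : ∀ v ∈ D, IsSmallRoot M v) {i j : Fin n} (hij : M i j = 0)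
    {v : Fin n → ℝ} (h : v ∈ stepSL M D i) : v j = 0 := by
  have hne := M.ne_of_eq_zero hij
  rcases mem_stepSL_iff.mp h with rfl | ⟨w, hw, rfl, hs⟩
  · simp [simpleRoot, hne.symm]
  · have hws : IsSmallRoot M w := by
      rcases hw with hw | ⟨l, -, rfl⟩
      exacts [hD w hw, .simple l]
    rw [simpleRefl_apply_of_ne M hne.symm]
    by_contra hj
    exact hws.not_isSmallRoot_simpleRefl hij hj hs

/-- If every root of a state is a smaller simple root or is joined to `i` by an `∞`-edge, then
reading `i` forgets the state. -/
theorem stepSL_eq_stepSL_empty {n : ℕ} {M : CoxeterMatrix (Fin n)} {D : Set (Fin n → ℝ)}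
    {i : Fin n} (hD : ∀ v ∈ D, IsSmallRoot M v)
    (h : ∀ v ∈ D, (∃ j, M i j = 0 ∧ v j ≠ 0) ∨ ∃ l < i, v = simpleRoot l) :
    stepSL M D i = stepSL M ∅ i := by
  ext v
  rw [mem_stepSL_iff, mem_stepSL_iff]
  refine or_congr_right ⟨?_, ?_⟩
  · rintro ⟨w, hw | hw, rfl, hs⟩
    · rcases h w hw with ⟨j, hij, hj⟩ | hl
      · exact absurd hs ((hD w hw).not_isSmallRoot_simpleRefl hij hj)
      · exact ⟨w, .inr hl, rfl, hs⟩
    · exact ⟨w, .inr hw, rfl, hs⟩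
  · rintro ⟨w, hw | hw, rfl, hs⟩
    · exact absurd hw (Set.notMem_empty w)
    · exact ⟨w, .inr hw, rfl, hs⟩

/-- The state `E` is obtained from the state `D` by reading some word. -/
def Leads {n : ℕ} (M : CoxeterMatrix (Fin n)) (D E : Set (Fin n → ℝ)) : Prop :=
  ∃ u : List (Fin n), DefinedFrom (stepSL M) D u ∧ run (stepSL M) D u = E

theorem Leads.refl {n : ℕ} (M : CoxeterMatrix (Fin n)) (D : Set (Fin n → ℝ)) : Leads M D D :=
  ⟨[], trivial, rfl⟩

theorem Leads.head {n : ℕ} {M : CoxeterMatrix (Fin n)} {D E : Set (Fin n → ℝ)} {i : Fin n}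
    (hi : simpleRoot i ∉ D) (h : Leads M (stepSL M D i) E) : Leads M D E := by
  obtain ⟨u, hu, hE⟩ := h
  exact ⟨i :: u, ⟨hi, hu⟩, hE⟩

theorem Leads.step {n : ℕ} {M : CoxeterMatrix (Fin n)} {D : Set (Fin n → ℝ)} {i : Fin n}
    (hi : simpleRoot i ∉ D) : Leads M D (stepSL M D i) :=
  .head hi (.refl M _)

theorem Leads.trans {n : ℕ} {M : CoxeterMatrix (Fin n)} {D E F : Set (Fin n → ℝ)}
    (h : Leads M D E) (h' : Leads M E F) : Leads M D F := by
  obtain ⟨u, hu, hE⟩ := h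
  induction u generalizing D with
  | nil => rwa [← show D = E from hE] at h'
  | cons i u ih => exact .head hu.1 (ih hu.2 hE)

/-- All roots of the state `E` are small and have no `∞`-neighbour of `i` in their support, as
is the case after reading the letter `i`. -/
def AvoidsNeighbors {n : ℕ} (M : CoxeterMatrix (Fin n)) (E : Set (Fin n → ℝ)) (i : Fin n) :
    Prop :=
  ∀ v ∈ E, IsSmallRoot M v ∧ ∀ j, M i j = 0 → v j = 0

/-- All roots of the state `E` are supported on the first `k` vertices. -/
def SupportedBelow {n : ℕ} (E : Set (Fin n → ℝ)) (k : ℕ) : Prop :=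
  ∀ v ∈ E, ∀ j : Fin n, k ≤ j → v j = 0

theorem avoidsNeighbors_stepSL {n : ℕ} {M : CoxeterMatrix (Fin n)} {D : Set (Fin n → ℝ)}
    (hD : ∀ v ∈ D, IsSmallRoot M v) (i : Fin n) : AvoidsNeighbors M (stepSL M D i) i :=
  fun _ hv => ⟨isSmallRoot_of_mem_stepSL hv, fun _ hij => apply_eq_zero_of_mem_stepSL hD hij hv⟩

theorem SupportedBelow.stepSL {n : ℕ} {M : CoxeterMatrix (Fin n)} {D : Set (Fin n → ℝ)}
    {k : ℕ} (hD : SupportedBelow D k) {i : Fin n} (hi : (i : ℕ) < k) :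
    SupportedBelow (stepSL M D i) k := by
  intro v hv j hj
  have hji : j ≠ i := by rintro rfl; omega
  rcases mem_stepSL_iff.mp hv with rfl | ⟨w, hw, rfl, -⟩
  · simp [simpleRoot, hji]
  · rw [simpleRefl_apply_of_ne M hji]
    rcases hw with hw | ⟨l, hl, rfl⟩
    · exact hD w hw j hj
    · have hjl : j ≠ l := by
        rintro rfl
        have : (j : ℕ) < i := hl
        omega
      simp [simpleRoot, hjl]

theorem AvoidsNeighbors.simpleRoot_notMem {n : ℕ} {M : CoxeterMatrix (Fin n)}
    {E : Set (Fin n → ℝ)} {i j : Fin n} (h : AvoidsNeighbors M E i) (hij : M i j = 0) :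
    simpleRoot j ∉ E := by
  intro hj
  simpa [simpleRoot] using (h _ hj).2 j hij

/-- From a state reached through `v` one may read any walk of `∞`-edges starting at `v`. -/
theorem exists_leads_of_walk {n : ℕ} {M : CoxeterMatrix (Fin n)} {Γ : SimpleGraph (Fin n)}
    (hΓ : ∀ i j, Γ.Adj i j → M i j = 0) {k : ℕ} {v z : Fin n} (p : Γ.Walk v z) :
    ∀ E, AvoidsNeighbors M E v → SupportedBelow E k → (∀ x ∈ p.support, (x : ℕ) < k) →
      ∃ E', Leads M E E' ∧ AvoidsNeighbors M E' z ∧ SupportedBelow E' k := by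
  induction p with
  | nil => exact fun E h h' _ => ⟨E, .refl M E, h, h'⟩
  | @cons a b c hab p ih =>
    intro E h h' hp
    have hb : (b : ℕ) < k := hp b (by simp)
    obtain ⟨E', hE, h1, h2⟩ := ih (stepSL M E b)
      (avoidsNeighbors_stepSL (fun v hv => (h v hv).1) b) (h'.stepSL hb)
      (fun x hx => hp x (by simp [hx]))
    exact ⟨E', .head (h.simpleRoot_notMem (hΓ _ _ hab)) hE, h1, h2⟩

theorem exists_leaf_path_extension {n : ℕ} {Γ : SimpleGraph (Fin n)} (hc : Γ.Connected)
    (hac : Γ.IsAcyclic) (hn : 2 ≤ n) {a v : Fin n} (p : Γ.Walk a v) (hp : p.IsPath) :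
    ∃ (w : Fin n) (q : Γ.Walk a w), q.IsPath ∧ (∃! x, Γ.Adj w x) ∧
      p.support <+: q.support := by
  induction hm : n - p.length using Nat.strong_induction_on generalizing v with
  | _ m ih =>
    by_cases hleaf : ∃! x, Γ.Adj v x
    · exact ⟨v, p, hp, hleaf, List.prefix_rfl⟩
    · have : Nontrivial (Fin n) := Fin.nontrivial_iff_two_le.mpr hn
      obtain ⟨x, hx⟩ := hc.preconnected.exists_adj_of_nontrivial v
      obtain ⟨y, hy, hyx⟩ : ∃ y, Γ.Adj v y ∧ y ≠ x := by
        by_contra! hcon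
        exact hleaf ⟨x, hx, hcon⟩
      obtain ⟨z, hz, hzp⟩ : ∃ z, Γ.Adj v z ∧ z ∉ p.support := by
        by_contra! hcon
        have hpen : ∀ z, Γ.Adj v z → z = p.penultimate := by
          intro z hz
          have h := hac.path_concat (hp.takeUntil (hcon z hz)) hp hz.symm (hcon z hz)
          rw [h, SimpleGraph.Walk.penultimate_concat]
        exact hyx ((hpen y hy).trans (hpen x hx).symm)
      have hpath : (p.concat hz).IsPath := hp.concat hzp hz
      have hlt : p.length < n := by simpa using hp.length_lt
      obtain ⟨w, q, hq, hw, hpre⟩ := ih (n - (p.concat hz).length)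
        (by rw [SimpleGraph.Walk.length_concat]; omega) (p.concat hz) hpath rfl
      refine ⟨w, q, hq, hw, List.IsPrefix.trans ?_ hpre⟩
      rw [SimpleGraph.Walk.support_concat]
      exact List.prefix_append _ _

/-- In an adapted labelling, every vertex other than the first has a smaller `∞`-neighbour
that is joined to the first vertex by a walk through smaller vertices. -/
theorem exists_adj_walk_lt {n : ℕ} {Γ : SimpleGraph (Fin n)} (hc : Γ.Connected)
    (hac : Γ.IsAcyclic) (hn : 2 ≤ n) {a : Fin n}
    (hinc : ∀ (v : Fin n) (p : Γ.Walk a v), p.IsPath → (∃! w : Fin n, Γ.Adj v w) →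
      p.support.IsChain (· < ·)) {k : Fin n} (hk : k ≠ a) :
    ∃ (b : Fin n) (p : Γ.Walk a b), Γ.Adj b k ∧ ∀ x ∈ p.support, x < k := by
  obtain ⟨p, hp⟩ := (hc a k).exists_isPath
  obtain ⟨w, q, hq, hw, hpre⟩ := exists_leaf_path_extension hc hac hn p hp
  have hpw : p.support.Pairwise (· < ·) :=
    ((hinc w q hq hw).pairwise).sublist hpre.sublist
  have hnil : ¬ p.Nil := SimpleGraph.Walk.not_nil_of_ne hk.symm
  have hadj := p.adj_penultimate hnil
  refine ⟨p.penultimate, p.dropLast, hadj, fun x hx => ?_⟩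
  have hcat := SimpleGraph.Walk.support_concat p.dropLast hadj
  rw [SimpleGraph.Walk.concat_dropLast] at hcat
  rw [hcat, List.pairwise_append] at hpw
  exact hpw.2.2 x hx k (by simp)

/-- If `M` is `∞`-spanned and the indexing is adapted as in the Labelling lemma, then the
shortlex automaton with the start state `∅` removed is strongly connected: any reachable
non-fail state `D'` other than `∅` can be reached from any reachable non-fail state `D`
other than `∅` by reading some word all of whose transitions are defined. -/
theorem strongly_connected_shortlex {n : ℕ} (hn : 3 ≤ n) (M : CoxeterMatrix (Fin n))
    (hspan : (infGraph M).Connected) (hadapt : AdaptedLabelling hn M) :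
    ∀ D D' : Set (Fin n → ℝ), Reachable (stepSL M) D → Reachable (stepSL M) D' →
      D ≠ ∅ → D' ≠ ∅ →
      ∃ u : List (Fin n), DefinedFrom (stepSL M) D u ∧ run (stepSL M) D u = D' := by
  obtain ⟨Γ, hle, hc, hac, h01, -, hinc⟩ := hadapt
  have hΓ : ∀ i j, Γ.Adj i j → M i j = 0 := by
    intro i j hij
    rcases (SimpleGraph.fromRel_adj _ _ _).mp (hle hij) with ⟨-, h | h⟩
    · exact h
    · rwa [M.symmetric]
  have hparent := fun k => exists_adj_walk_lt hc hac (by omega) hinc (k := k)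
  set a : Fin n := ⟨0, by omega⟩ with ha
  have hempty : ∀ v ∈ (∅ : Set (Fin n → ℝ)), IsSmallRoot M v := fun v hv => absurd hv (by simp)
  have hfromFirst : ∀ k, Leads M (stepSL M ∅ a) (stepSL M ∅ k) := by
    intro k
    induction k using WellFoundedLT.induction with
    | _ k ih =>
      by_cases hk : k = a
      · rw [hk]
        exact .refl M _
      · obtain ⟨b, p, hbk, hlt⟩ := hparent k hk
        have hb : b < k := hlt b (by simp)
        have hM := hΓ _ _ hbk
        have havoid := avoidsNeighbors_stepSL (M := M) hempty b
        have hforget : stepSL M (stepSL M ∅ b) k = stepSL M ∅ k := by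
          refine stepSL_eq_stepSL_empty (fun v hv => (havoid v hv).1) fun v hv => ?_
          by_cases hvb : v b = 0
          · right
            rcases mem_stepSL_iff.mp hv with rfl | ⟨w, hw | ⟨l, hl, rfl⟩, rfl, -⟩
            · simp [simpleRoot] at hvb
            · exact absurd hw (Set.notMem_empty w)
            · refine ⟨l, hl.trans hb, ?_⟩
              rw [simpleRefl_apply_self] at hvb
              have hz : bform M (simpleRoot l) (simpleRoot b) = 0 := by
                have : (simpleRoot l : Fin n → ℝ) b = 0 := by simp [simpleRoot, hl.ne']
                linarith
              simp [simpleRefl, hz]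
          · exact .inl ⟨b, by rwa [M.symmetric], hvb⟩
        refine (ih b hb).trans ?_
        rw [← hforget]
        exact .step (havoid.simpleRoot_notMem hM)
  have hdescend : ∀ k : ℕ, k < n → ∀ E, AvoidsNeighbors M E a → SupportedBelow E (k + 1) →
      ∃ E', Leads M E E' ∧ AvoidsNeighbors M E' a ∧ SupportedBelow E' 1 := by
    intro k
    induction k with
    | zero => exact fun _ E h h' => ⟨E, .refl M E, h, h'⟩
    | succ k ih =>
      intro hk E h h'
      obtain ⟨b, p, hbk, hlt⟩ := hparent ⟨k + 1, hk⟩ (by simp [ha])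
      have hlt' : ∀ x ∈ p.support, (x : ℕ) < k + 1 := fun x hx => hlt x hx
      obtain ⟨E₁, hE₁, hav₁, hsup₁⟩ := exists_leads_of_walk hΓ p E h h'
        fun x hx => (hlt' x hx).trans (Nat.lt_succ_self _)
      have hsup₁' : SupportedBelow E₁ (k + 1) := by
        intro v hv j hj
        rcases hj.eq_or_lt with hj | hj
        · have hjk : (⟨k + 1, hk⟩ : Fin n) = j := Fin.ext hj
          exact (hav₁ v hv).2 j (hjk ▸ hΓ _ _ hbk)
        · exact hsup₁ v hv j hj
      obtain ⟨E₂, hE₂, hav₂, hsup₂⟩ := exists_leads_of_walk hΓ p.reverse E₁ hav₁ hsup₁'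
        fun x hx => hlt' x (by simpa using hx)
      obtain ⟨E', hE', hfin⟩ := ih (by omega) E₂ hav₂ hsup₂
      exact ⟨E', (hE₁.trans hE₂).trans hE', hfin⟩
  have htoFirst : ∀ (D : Set (Fin n → ℝ)) (s : Fin n), AvoidsNeighbors M D s →
      Leads M D (stepSL M ∅ a) := by
    intro D s hD
    obtain ⟨p⟩ := hc s a
    obtain ⟨E, hE, hav, -⟩ := exists_leads_of_walk hΓ p D hD
      (fun v _ j hj => absurd j.isLt (not_lt.mpr hj)) (fun x _ => x.isLt)
    obtain ⟨F, hF, havF, hsupF⟩ := hdescend (n - 1) (by omega) E hav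
      (fun v _ j hj => absurd j.isLt (by omega))
    have hM := hΓ _ _ h01
    have hM' := hΓ _ _ h01.symm
    have hsmall := fun v hv => (havF v hv).1
    have hforget : stepSL M F ⟨1, by omega⟩ = stepSL M ∅ ⟨1, by omega⟩ := by
      refine stepSL_eq_stepSL_empty hsmall fun v hv => .inl ⟨a, hM', ?_⟩
      obtain ⟨j, hj⟩ := (hsmall v hv).exists_ne_zero
      have hja : j = a := by
        by_contra hne
        refine hj (hsupF v hv j (Nat.one_le_iff_ne_zero.mpr fun h0 => hne (Fin.ext h0)))
      rwa [← hja]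
    have hav1 := avoidsNeighbors_stepSL (M := M) hempty (⟨1, by omega⟩ : Fin n)
    have hforget' : stepSL M (stepSL M ∅ ⟨1, by omega⟩) a = stepSL M ∅ a := by
      refine stepSL_eq_stepSL_empty (fun v hv => (hav1 v hv).1) fun v hv =>
        .inl ⟨⟨1, by omega⟩, hM, ?_⟩
      rcases mem_stepSL_iff.mp hv with rfl | ⟨w, hw | ⟨l, hl, rfl⟩, rfl, hs⟩
      · simp [simpleRoot]
      · exact absurd hw (Set.notMem_empty w)
      · have hla : l = a := Fin.ext (Nat.lt_one_iff.mp hl)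
        subst hla
        exact absurd hs ((IsSmallRoot.simple _).not_isSmallRoot_simpleRefl hM'
          (by simp [simpleRoot]))
    refine (hE.trans hF).trans (.head (havF.simpleRoot_notMem hM) ?_)
    rw [hforget, ← hforget']
    exact .step (hav1.simpleRoot_notMem hM')
  have hlast : ∀ (u : List (Fin n)) (D : Set (Fin n → ℝ)), (∀ v ∈ D, IsSmallRoot M v) →
      u ≠ [] → ∃ s, AvoidsNeighbors M (run (stepSL M) D u) s := by
    intro u
    induction u with
    | nil => exact fun _ _ h => absurd rfl h
    | cons i u ih =>
      intro D hD _
      by_cases hu : u = []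
      · subst hu
        exact ⟨i, avoidsNeighbors_stepSL hD i⟩
      · exact ih (stepSL M D i) (fun v hv => isSmallRoot_of_mem_stepSL hv) hu
  rintro D D' ⟨u, -, rfl⟩ ⟨u', hu', rfl⟩ hne hne'
  obtain ⟨s, hs⟩ := hlast u ∅ hempty (by rintro rfl; exact hne rfl)
  cases u' with
  | nil => exact absurd rfl hne'
  | cons i u' => exact ((htoFirst _ s hs).trans (hfromFirst i)).trans ⟨u', hu'.2, rfl⟩
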